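/- The 4×4 real matrix M₄ = !![−3, √3, 0, 0; −√3, −1, 2, 0; 0, −2, 1, √3; 0, 0, −√3, 3] (the matrix R₄(τ,σ) at the Big-Bang exceptional-point values τ = 1, σ = 0) is nilpotent with characteristic polynomial X⁴ (so M₄⁴ = 0), M₄ ≠ 0, and M₄ is not diagonalizable. -/

import Mathlib

open Matrix Polynomial

/-- A nilpotent matrix over an integral domain has characteristic polynomial `X ^ n`. -/
theorem charpoly_eq_X_pow_of_isNilpotent {R n : Type*} [CommRing R] [IsDomain R] [Fintype n]
    [DecidableEq n] {A : Matrix n n R} (hA : IsNilpotent A) :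
    A.charpoly = X ^ Fintype.card n :=
  sub_eq_zero.mp (Matrix.isNilpotent_charpoly_sub_pow_of_isNilpotent hA).eq_zero

/-- A nilpotent matrix that is similar to a diagonal matrix vanishes. -/
theorem eq_zero_of_isNilpotent_of_eq_conj_diagonal {K n : Type*} [Field K] [Fintype n]
    [DecidableEq n] {A P : Matrix n n K} {d : n → K} (hA : IsNilpotent A) (hP : IsUnit P)
    (h : A = P * diagonal d * P⁻¹) : A = 0 := by
  obtain ⟨k, hk⟩ := hA
  have hdet : IsUnit P.det := (Matrix.isUnit_iff_isUnit_det P).mp hP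
  have hPow : ∀ m : ℕ, A ^ m * P = P * diagonal d ^ m := by
    intro m
    induction m with
    | zero => simp
    | succ m ih =>
      have h1 : A * P = P * diagonal d := by
        rw [h, Matrix.mul_assoc, Matrix.nonsing_inv_mul P hdet, Matrix.mul_one]
      rw [pow_succ, Matrix.mul_assoc, h1, ← Matrix.mul_assoc, ih, Matrix.mul_assoc, ← pow_succ]
  have hD : diagonal d ^ k = 0 :=
    hP.mul_left_cancel (by rw [← hPow k, hk, Matrix.zero_mul, Matrix.mul_zero])
  have hd : d = 0 := by
    rw [Matrix.diagonal_pow, Matrix.diagonal_eq_zero] at hD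
    exact eq_zero_of_pow_eq_zero hD
  rw [h, hd, Matrix.diagonal_zero', Matrix.mul_zero, Matrix.zero_mul]

/-- **The Big-Bang exceptional point for N = 4.** The matrix
`M₄ = !![−3, √3, 0, 0; −√3, −1, 2, 0; 0, −2, 1, √3; 0, 0, −√3, 3]`
(`R₄(τ,σ)` at `τ = 1`, `σ = 0`) is nilpotent with characteristic polynomial `X⁴`
(so `M₄ ^ 4 = 0`), is nonzero, and is not diagonalizable. -/
theorem bigBang_EP4
    (M : Matrix (Fin 4) (Fin 4) ℝ)
    (hM : M = !![-3, Real.sqrt 3, 0, 0;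
                 -(Real.sqrt 3), -1, 2, 0;
                 0, -2, 1, Real.sqrt 3;
                 0, 0, -(Real.sqrt 3), 3]) :
    IsNilpotent M ∧ M.charpoly = X ^ 4 ∧ M ^ 4 = 0 ∧ M ≠ 0 ∧
    ¬ ∃ (P : Matrix (Fin 4) (Fin 4) ℂ) (d : Fin 4 → ℂ),
        IsUnit P ∧ M.map (Complex.ofReal) = P * Matrix.diagonal d * P⁻¹ := by
  have h3 : √(3 : ℝ) * √3 = 3 := Real.mul_self_sqrt (by norm_num)
  have hsq : M ^ 2 = !![6, -4 * √3, 2 * √3, 0;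
                        4 * √3, -6, 0, 2 * √3;
                        2 * √3, 0, -6, 4 * √3;
                        0, 2 * √3, -4 * √3, 6] := by
    rw [hM, sq]
    ext i j
    fin_cases i <;> fin_cases j <;>
      simp [Matrix.mul_apply, Fin.sum_univ_four] <;> linarith
  have h4 : M ^ 4 = 0 := by
    rw [show M ^ 4 = M ^ 2 * M ^ 2 from pow_add M 2 2, hsq]
    ext i j
    fin_cases i <;> fin_cases j <;>
      simp [Matrix.mul_apply, Fin.sum_univ_four] <;> linarith
  have hnil : IsNilpotent M := ⟨4, h4⟩
  have hne : M ≠ 0 := by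
    intro h
    have h00 := congrFun (congrFun (hM.symm.trans h) 0) 0
    norm_num at h00
  refine ⟨hnil, by simpa using charpoly_eq_X_pow_of_isNilpotent hnil, h4, hne, ?_⟩
  rintro ⟨P, d, hP, h⟩
  have hnil' : IsNilpotent (M.map Complex.ofReal) :=
    hnil.map (Complex.ofRealHom.mapMatrix (m := Fin 4))
  have h0 := eq_zero_of_isNilpotent_of_eq_conj_diagonal hnil' hP h
  apply hne
  ext i j
  exact Complex.ofReal_eq_zero.mp (congrFun (congrFun h0 i) j)
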